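/- arXiv:math/0209073 — 13 statements merged into one kernel-verified Lean document; each statement's English description precedes it below -/
import Mathlib

section
/- A finite abelian group G admits a near-group permutation if and only if G is isomorphic to the multiplicative group of units of some finite field; equivalently, if and only if there exist a prime p and a positive integer α such that G is cyclic of order p^α − 1. (Theorem 6.1 of the paper.) -/
/-- A near-group permutation on a group `G`, encoded as a permutation of `G`
fixing the identity (equivalently, a bijection of the nonidentity elements of `G`
onto themselves), satisfying:
(i) `π ∘ π ∘ π = id`;
(ii) `π(x)⁻¹ = π⁻¹(x⁻¹)` for every nonidentity `x`;
(iii) `π(s·t) = π(t) · π(π(s)⁻¹ · π(t⁻¹))` for all nonidentity `s, t` with `s ≠ t⁻¹`. -/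
def IsNearGroupPerm {G : Type*} [Group G] (π : Equiv.Perm G) : Prop :=
  π 1 = 1 ∧
  (∀ x : G, π (π (π x)) = x) ∧
  (∀ x : G, x ≠ 1 → (π x)⁻¹ = π.symm x⁻¹) ∧
  (∀ s t : G, s ≠ 1 → t ≠ 1 → s ≠ t⁻¹ → π (s * t) = π t * π ((π s)⁻¹ * π t⁻¹))

/-- In additive notation: an involution `N` of the nonzero elements of `A` that behaves like
`x ↦ 1 - x` on the multiplicative group of a field determines an element `e` playing the role
of `-1`. -/
theorem exists_negOne_of_complement {A : Type*} [AddCommGroup A] (N : A → A)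
    (h0 : ∀ x, x ≠ 0 → N x ≠ 0) (hNN : ∀ x, x ≠ 0 → N (N x) = x)
    (hS : ∀ x, x ≠ 0 → N (-N x) = -N (-x))
    (hT : ∀ s t, s ≠ 0 → t ≠ 0 → s ≠ t → N (s - t) = N (-t) + N (N s - N t)) :
    ∃ e : A, e + e = 0 ∧ ∀ x, x ≠ 0 → N x = e + x + N (-x) := by
  let E : A → A := fun x => N x - x - N (-x)
  have hE : ∀ x, E x = N x - x - N (-x) := fun _ => rfl
  have E_neg : ∀ x, E (-x) = -E x := by
    intro x
    rw [hE, hE, neg_neg]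
    abel
  have E_N : ∀ x, x ≠ 0 → E (N x) = -E x := by
    intro x hx
    rw [hE, hE, hNN x hx, hS x hx]
    abel
  have N_inj : ∀ s t, s ≠ 0 → t ≠ 0 → N s = N t → s = t := by
    intro s t hs ht h
    rw [← hNN s hs, h, hNN t ht]
  have E_sub : ∀ s t, s ≠ 0 → t ≠ 0 → s ≠ t → E (N s - N t) = E (s - t) + E t - E s := by
    intro s t hs ht hst
    have h1 := hT s t hs ht hst
    have h2 := hT t s ht hs hst.symm
    rw [hE, hE, hE, hE, neg_sub, neg_sub, h1, h2]
    abel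
  let P : A → A := fun x => -N x
  have hP : ∀ x, P x = -N x := fun _ => rfl
  have P_ne : ∀ x, x ≠ 0 → P x ≠ 0 := fun x hx => neg_ne_zero.mpr (h0 x hx)
  have P_inj : ∀ s t, s ≠ 0 → t ≠ 0 → s ≠ t → P s ≠ P t :=
    fun s t hs ht hst h => hst (N_inj s t hs ht (neg_injective h))
  have P_cube : ∀ x, x ≠ 0 → P (P (P x)) = x := by
    intro x hx
    rw [hP (P (P x)), hP (P x), hP x, hS x hx, neg_neg, hNN _ (neg_ne_zero.mpr hx), neg_neg]
  have E_P : ∀ x, x ≠ 0 → E (P x) = E x := by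
    intro x hx
    rw [hP, E_neg, E_N x hx, neg_neg]
  have E_P_sub : ∀ s t, s ≠ 0 → t ≠ 0 → s ≠ t →
      E (P s - P t) = E s - E t - E (s - t) := by
    intro s t hs ht hst
    rw [show P s - P t = -(N s - N t) by rw [hP, hP]; abel, E_neg, E_sub s t hs ht hst]
    abel
  have E_double : ∀ s t, s ≠ 0 → t ≠ 0 → s ≠ t → E (s - t) + E (s - t) = E s - E t := by
    intro s t hs ht hst
    have h1 := E_P_sub s t hs ht hst
    have h2 := E_P_sub _ _ (P_ne s hs) (P_ne t ht) (P_inj s t hs ht hst)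
    have h3 := E_P_sub _ _ (P_ne _ (P_ne s hs)) (P_ne _ (P_ne t ht))
      (P_inj _ _ (P_ne s hs) (P_ne t ht) (P_inj s t hs ht hst))
    rw [P_cube s hs, P_cube t ht] at h3
    simp only [E_P _ (P_ne s hs), E_P _ (P_ne t ht), E_P s hs, E_P t ht] at h1 h2 h3
    rw [h2, h1] at h3
    nth_rewrite 1 [h3]
    abel
  have E_eq : ∀ u t, u ≠ 0 → t ≠ 0 → u + t ≠ 0 → E u = E t := by
    intro u t hu ht hut
    have h1 := E_double (u + t) t hut ht (by simpa using hu)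
    have h2 := E_double (u + t) u hut hu (by simpa using ht)
    rw [add_sub_cancel_right] at h1
    rw [add_sub_cancel_left] at h2
    grind
  have E_eq_neg : ∀ u, u ≠ 0 → E u = E (-u) := by
    intro u hu
    by_cases hw : ∃ w, w ≠ 0 ∧ w ≠ u ∧ w ≠ -u
    · obtain ⟨w, hw0, hwu, hwu'⟩ := hw
      have hu' : -u ≠ 0 := neg_ne_zero.mpr hu
      rw [E_eq u w hu hw0 (fun h => hwu' (eq_neg_of_add_eq_zero_right h)),
        E_eq (-u) w hu' hw0 (fun h => hwu (by simpa using eq_neg_of_add_eq_zero_right h))]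
    · push Not at hw
      by_cases huu : u = -u
      · rw [← huu]
      have hu' : -u ≠ 0 := neg_ne_zero.mpr hu
      have h3 : u + u = -u := by
        apply hw
        · exact fun h => huu (eq_neg_of_add_eq_zero_left h)
        · simpa using hu
      have hNu : N u = -u := by
        apply hw _ (h0 u hu)
        intro h
        have h4 := hS u hu
        rw [h] at h4
        have h5 : N (-u) = -u := hw _ (h0 _ hu') fun h' => huu (N_inj u (-u) hu hu' (h.trans h'.symm))
        rw [h5, neg_neg] at h4
        exact huu h4.symm
      have hNu' : N (-u) = u := by rw [← hNu, hNN u hu]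
      rw [hE, hE, neg_neg, hNu, hNu']
      grind
  have E_const : ∀ u t, u ≠ 0 → t ≠ 0 → E u = E t := by
    intro u t hu ht
    by_cases h : u + t = 0
    · rw [eq_neg_of_add_eq_zero_right h]
      exact E_eq_neg u hu
    · exact E_eq u t hu ht h
  by_cases hA : ∃ a : A, a ≠ 0
  · obtain ⟨a, ha⟩ := hA
    refine ⟨E a, ?_, fun x hx => ?_⟩
    · nth_rewrite 1 [E_eq_neg a ha]
      rw [E_neg, neg_add_cancel]
    · rw [E_const a x ha hx, hE]
      abel
  · push Not at hA
    exact ⟨0, add_zero 0, fun x hx => absurd (hA x) hx⟩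

/-- `M` satisfies the multiplicative identities of the map `x ↦ 1 - x` of a field in which
`-1 = e`. -/
structure IsOneSub {K : Type*} [CommGroupWithZero K] (M : K → K) (e : K) : Prop where
  sq_eq_one : e * e = 1
  map_zero : M 0 = 1
  map_one : M 1 = 0
  map_map : ∀ x, M (M x) = x
  map_eq : ∀ x, x ≠ 0 → M x = e * x * M x⁻¹
  map_div : ∀ s t, t ≠ 0 → t ≠ 1 → M (s / t) = M t⁻¹ * M (M s / M t)

namespace IsOneSub

variable {K : Type*} [CommGroupWithZero K] {M : K → K} {e : K}

theorem ne_zero (h : IsOneSub M e) : e ≠ 0 := left_ne_zero_of_mul_eq_one h.sq_eq_one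

theorem map_ne_zero (h : IsOneSub M e) {x : K} (hx : x ≠ 1) : M x ≠ 0 := fun h' =>
  hx (by rw [← h.map_map x, h', h.map_zero])

theorem map_ne_one (h : IsOneSub M e) {x : K} (hx : x ≠ 0) : M x ≠ 1 := fun h' =>
  hx (by rw [← h.map_map x, h', h.map_one])

theorem map_mul_map_inv_map (h : IsOneSub M e) {x : K} (hx : x ≠ 0) (hx1 : x ≠ 1) :
    M x * M (M x)⁻¹ = e * x := by
  have h1 := h.map_div 0 x hx hx1
  rw [zero_div, h.map_zero, one_div] at h1
  rw [h.map_eq x hx, mul_assoc, ← h.map_eq x hx, ← h1, mul_one]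

theorem map_mul_map_div_map (h : IsOneSub M e) {a b : K} (ha : a ≠ 0) (ha1 : a ≠ 1)
    (hb1 : b ≠ 1) : M a * M (b / M a) = M b * M (a / M b) := by
  rw [h.map_div b (M a) (h.map_ne_zero ha1) (h.map_ne_one ha), h.map_map, ← mul_assoc,
    h.map_mul_map_inv_map ha ha1, h.map_eq (M b / a) (div_ne_zero (h.map_ne_zero hb1) ha), inv_div]
  calc e * a * (e * (M b / a) * M (a / M b))
      = (e * e) * (a * (M b / a)) * M (a / M b) := by ac_rfl
    _ = M b * M (a / M b) := by rw [h.sq_eq_one, mul_div_cancel₀ _ ha, one_mul]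

open Classical in
/-- The addition `x + y = x * (1 - (-y / x))` recovered from `M` and `e`. -/
noncomputable def add (M : K → K) (e x y : K) : K :=
  if x = 0 then y else x * M (e * y / x)

theorem zero_add (x : K) : add M e 0 x = x := if_pos rfl

theorem add_of_ne_zero {x : K} (hx : x ≠ 0) (y : K) : add M e x y = x * M (e * y / x) := if_neg hx

theorem add_zero (h : IsOneSub M e) (x : K) : add M e x 0 = x := by
  by_cases hx : x = 0
  · rw [hx, zero_add]
  · rw [add_of_ne_zero hx, mul_zero, zero_div, h.map_zero, mul_one]

theorem add_comm (h : IsOneSub M e) (x y : K) : add M e x y = add M e y x := by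
  by_cases hx : x = 0
  · rw [hx, zero_add, h.add_zero]
  by_cases hy : y = 0
  · rw [hy, zero_add, h.add_zero]
  have he := h.ne_zero
  have h2 : (e * y / x)⁻¹ = e * x / y := by
    rw [inv_div, div_eq_div_iff (mul_ne_zero he hy) hy]
    calc x * y = (e * e) * (x * y) := by rw [h.sq_eq_one, one_mul]
      _ = e * x * (e * y) := by ac_rfl
  rw [add_of_ne_zero hx, add_of_ne_zero hy,
    h.map_eq (e * y / x) (div_ne_zero (mul_ne_zero he hy) hx), h2]
  calc x * (e * (e * y / x) * M (e * x / y))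
      = (e * e) * (x * (y / x)) * M (e * x / y) := by rw [mul_div_assoc]; ac_rfl
    _ = y * M (e * x / y) := by rw [h.sq_eq_one, mul_div_cancel₀ _ hx, one_mul]

theorem mul_add (x y z : K) : x * add M e y z = add M e (x * y) (x * z) := by
  by_cases hx : x = 0
  · rw [hx, zero_mul, zero_mul, zero_mul, zero_add]
  by_cases hy : y = 0
  · rw [hy, mul_zero, zero_add, zero_add]
  rw [add_of_ne_zero hy, add_of_ne_zero (mul_ne_zero hx hy), mul_left_comm e x z,
    mul_div_mul_left _ _ hx, mul_assoc]

theorem mul_self_cancel_left (h : IsOneSub M e) (x : K) : e * (e * x) = x := by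
  rw [← mul_assoc, h.sq_eq_one, one_mul]

theorem add_mul_self (h : IsOneSub M e) (x : K) : add M e x (e * x) = 0 := by
  by_cases hx : x = 0
  · rw [hx, zero_add, mul_zero]
  · rw [add_of_ne_zero hx, h.mul_self_cancel_left, div_self hx, h.map_one, mul_zero]

theorem one_add (x : K) : add M e 1 x = M (e * x) := by
  rw [add_of_ne_zero one_ne_zero, one_mul, div_one]

theorem map_one_add (h : IsOneSub M e) (b : K) : add M e (M b) e = e * b := by
  by_cases hb1 : b = 1
  · rw [hb1, h.map_one, zero_add, mul_one]
  by_cases hb : b = 0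
  · have := h.add_mul_self 1
    rw [mul_one] at this
    rw [hb, h.map_zero, this, mul_zero]
  rw [add_of_ne_zero (h.map_ne_zero hb1), h.sq_eq_one, one_div, h.map_mul_map_inv_map hb hb1]

theorem map_add_mul (h : IsOneSub M e) (a b : K) :
    add M e (M a) (e * b) = add M e (M b) (e * a) := by
  by_cases ha : a = 0
  · rw [ha, h.map_zero, mul_zero, h.add_zero, one_add, h.mul_self_cancel_left]
  by_cases hb : b = 0
  · rw [hb, h.map_zero, mul_zero, h.add_zero, one_add, h.mul_self_cancel_left]
  by_cases ha1 : a = 1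
  · rw [ha1, h.map_one, zero_add, mul_one, h.map_one_add]
  by_cases hb1 : b = 1
  · rw [hb1, h.map_one, zero_add, mul_one, h.map_one_add]
  rw [add_of_ne_zero (h.map_ne_zero ha1), add_of_ne_zero (h.map_ne_zero hb1),
    h.mul_self_cancel_left, h.mul_self_cancel_left, h.map_mul_map_div_map ha ha1 hb1]

theorem add_right_comm (h : IsOneSub M e) (x y z : K) :
    add M e (add M e x y) z = add M e (add M e x z) y := by
  by_cases hx : x = 0
  · rw [hx, zero_add, zero_add, h.add_comm]
  have key : ∀ y z : K, add M e (add M e x y) z =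
      x * add M e (M (e * (y / x))) (e * (e * (z / x))) := by
    intro y z
    rw [mul_add, h.mul_self_cancel_left, mul_div_cancel₀ _ hx, ← one_add (M := M) (e := e),
      mul_add, mul_one, mul_div_cancel₀ _ hx]
  rw [key, key, h.map_add_mul]

theorem add_assoc (h : IsOneSub M e) (x y z : K) :
    add M e (add M e x y) z = add M e x (add M e y z) := by
  rw [h.add_comm x y, h.add_right_comm, h.add_comm]

/-- The field structure recovered from its multiplication and the map `x ↦ 1 - x`. -/
@[reducible] noncomputable def field (h : IsOneSub M e) : Field K :=
  letI : Add K := ⟨add M e⟩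
  letI : Neg K := ⟨fun x => e * x⟩
  { ‹CommGroupWithZero K› with
    add_assoc := h.add_assoc
    zero_add := zero_add
    add_zero := h.add_zero
    add_comm := h.add_comm
    neg_add_cancel := fun x => (h.add_comm _ _).trans (h.add_mul_self x)
    left_distrib := mul_add
    right_distrib := fun x y z => by
      change add M e x y * z = add M e (x * z) (y * z)
      rw [mul_comm, mul_add, mul_comm z, mul_comm z]
    nsmul := nsmulRec
    zsmul := zsmulRec
    nnqsmul := _
    qsmul := _ }

end IsOneSub


namespace IsNearGroupPerm

theorem inv_mul_inv_ne_one {G : Type*} [Group G] {π : Equiv.Perm G} (h : IsNearGroupPerm π) {x : G}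
    (hx : x ≠ 1) : (π x)⁻¹ ≠ 1 := by
  rw [Ne, inv_eq_one, ← h.1, π.apply_eq_iff_eq]
  exact hx

theorem conj {G H : Type*} [Group G] [Group H] {π : Equiv.Perm G} (h : IsNearGroupPerm π)
    (f : G ≃* H) : IsNearGroupPerm (f.toEquiv.permCongr π) := by
  obtain ⟨h1, h2, h3, h4⟩ := h
  have hf : ∀ x, f.toEquiv.permCongr π x = f (π (f.symm x)) := fun _ => rfl
  have hf' : ∀ x, (f.toEquiv.permCongr π).symm x = f (π.symm (f.symm x)) := fun _ => rfl
  refine ⟨by simp [h1], fun x => by simp [h2], fun x hx => ?_, fun s t hs ht hst => ?_⟩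
  · rw [hf, hf', map_inv f.symm, ← h3 _ (by simpa using hx), map_inv]
  · simp only [hf, map_mul, map_inv, MulEquiv.symm_apply_apply]
    rw [h4 _ _ (by simpa using hs) (by simpa using ht) (by rwa [← map_inv, f.symm.injective.ne_iff]),
      map_mul]

/-- A near-group permutation yields the map `x ↦ 1 - x = (π x)⁻¹` on `G` with a zero adjoined. -/
theorem exists_isOneSub {G : Type*} [CommGroup G] {π : Equiv.Perm G} (h : IsNearGroupPerm π) :
    ∃ (M : WithZero G → WithZero G) (e : WithZero G), IsOneSub M e := by
  classical
  obtain ⟨h1, h2, h3, h4⟩ := id h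
  let N : G → G := fun x => (π x)⁻¹
  have N_inj : Function.Injective N := inv_injective.comp π.injective
  have N_ne : ∀ x, x ≠ 1 → N x ≠ 1 := fun x hx => h.inv_mul_inv_ne_one hx
  have N_N : ∀ x, x ≠ 1 → N (N x) = x := by
    intro x hx
    change (π (π x)⁻¹)⁻¹ = x
    rw [h3 x hx, π.apply_symm_apply, inv_inv]
  have N_inv : ∀ x, x ≠ 1 → N (N x)⁻¹ = (N x⁻¹)⁻¹ := by
    intro x hx
    change (π ((π x)⁻¹)⁻¹)⁻¹ = ((π x⁻¹)⁻¹)⁻¹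
    rw [h3 x⁻¹ (inv_ne_one.mpr hx), inv_inv, inv_inv, inv_inj, Equiv.eq_symm_apply, h2]
  have N_div : ∀ s t, s ≠ 1 → t ≠ 1 → s ≠ t → N (s / t) = N t⁻¹ * N (N s / N t) := by
    intro s t hs ht hst
    change (π (s / t))⁻¹ = (π t⁻¹)⁻¹ * (π ((π s)⁻¹ / (π t)⁻¹))⁻¹
    rw [div_eq_mul_inv, h4 s t⁻¹ hs (inv_ne_one.mpr ht) (by rwa [inv_inv]), inv_inv, mul_inv,
      div_inv_eq_mul]
  obtain ⟨e, he, hNe⟩ : ∃ e : G, e * e = 1 ∧ ∀ x, x ≠ 1 → N x = e * x * N x⁻¹ :=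
    exists_negOne_of_complement (A := Additive G) N N_ne N_N N_inv N_div
  let M : WithZero G → WithZero G :=
    WithZero.recZeroCoe 1 fun x => if x = 1 then 0 else (N x : G)
  have M_zero : M 0 = 1 := rfl
  have M_one : M 1 = 0 := if_pos rfl
  have M_coe : ∀ x : G, x ≠ 1 → M x = (N x : G) := fun x hx => if_neg hx
  refine ⟨M, (e : G), ?_, M_zero, M_one, ?_, ?_, ?_⟩
  · exact_mod_cast he
  · intro x
    induction x using WithZero.recZeroCoe with
    | zero => rw [M_zero, M_one]
    | coe x =>
      by_cases hx : x = 1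
      · rw [hx, WithZero.coe_one, M_one, M_zero]
      · rw [M_coe x hx, M_coe _ (N_ne x hx), N_N x hx]
  · intro x hx0
    lift x to G using hx0
    by_cases hx : x = 1
    · rw [hx, WithZero.coe_one, inv_one, M_one, mul_zero]
    · rw [← WithZero.coe_inv, M_coe x hx, M_coe _ (inv_ne_one.mpr hx), hNe x hx]
      push_cast
      rfl
  · intro s t ht0 ht1
    lift t to G using ht0
    replace ht1 : t ≠ 1 := by exact_mod_cast ht1
    rw [← WithZero.coe_inv, M_coe t ht1, M_coe _ (inv_ne_one.mpr ht1)]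
    induction s using WithZero.recZeroCoe with
    | zero =>
      rw [zero_div, M_zero, one_div, ← WithZero.coe_inv, M_coe _ (inv_ne_one.mpr (N_ne t ht1)),
        N_inv t ht1, ← WithZero.coe_mul, mul_inv_cancel, WithZero.coe_one]
    | coe s =>
      by_cases hs : s = 1
      · rw [hs, WithZero.coe_one, M_one, zero_div, M_zero, mul_one, one_div, ← WithZero.coe_inv,
          M_coe _ (inv_ne_one.mpr ht1)]
      by_cases hst : s = t
      · rw [hst, M_coe t ht1, div_self WithZero.coe_ne_zero, div_self WithZero.coe_ne_zero, M_one,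
          mul_zero]
      rw [M_coe s hs, ← WithZero.coe_div, ← WithZero.coe_div, M_coe _ (div_ne_one.mpr hst),
        M_coe _ (div_ne_one.mpr (N_inj.ne hst)), N_div s t hs ht1 hst, WithZero.coe_mul]

end IsNearGroupPerm

open Classical in
/-- The map `x ↦ 1 / (1 - x)` on the units of a field, extended by `1 ↦ 1`. -/
noncomputable def Units.invOneSub {F : Type*} [Field F] (x : Fˣ) : Fˣ :=
  if hx : x = 1 then 1
  else (Units.mk0 (1 - (x : F)) (sub_ne_zero.mpr fun h => hx (Units.ext h.symm)))⁻¹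

namespace Units

variable {F : Type*} [Field F]

theorem invOneSub_one : invOneSub (1 : Fˣ) = 1 := dif_pos rfl

theorem val_invOneSub {x : Fˣ} (hx : x ≠ 1) : (invOneSub x : F) = (1 - (x : F))⁻¹ := by
  rw [invOneSub, dif_neg hx, val_inv_eq_inv_val, val_mk0]

theorem one_sub_val_ne_zero {x : Fˣ} (hx : x ≠ 1) : 1 - (x : F) ≠ 0 :=
  sub_ne_zero.mpr fun h => hx (ext h.symm)

theorem invOneSub_ne_one {x : Fˣ} (hx : x ≠ 1) : invOneSub x ≠ 1 := by
  intro h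
  have h1 := val_invOneSub hx
  rw [h, val_one, eq_comm, inv_eq_one] at h1
  exact x.ne_zero (by linear_combination -h1)

theorem val_invOneSub_invOneSub {x : Fˣ} (hx : x ≠ 1) :
    (invOneSub (invOneSub x) : F) = 1 - (x : F)⁻¹ := by
  have h1 := one_sub_val_ne_zero hx
  have h2 := x.ne_zero
  have h3 : 1 - (1 - (x : F))⁻¹ ≠ 0 := by
    rw [← val_invOneSub hx]
    exact one_sub_val_ne_zero (invOneSub_ne_one hx)
  rw [val_invOneSub (invOneSub_ne_one hx), val_invOneSub hx, inv_eq_iff_eq_inv]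
  apply eq_inv_of_mul_eq_one_left
  field_simp
  ring

theorem invOneSub_cube (x : Fˣ) : invOneSub (invOneSub (invOneSub x)) = x := by
  by_cases hx : x = 1
  · simp only [hx, invOneSub_one]
  · ext
    rw [val_invOneSub (invOneSub_ne_one (invOneSub_ne_one hx)), val_invOneSub_invOneSub hx,
      sub_sub_cancel, inv_inv]

/-- The map `x ↦ 1 / (1 - x)` as a permutation of the units of a field. -/
noncomputable def invOneSubPerm (F : Type*) [Field F] : Equiv.Perm Fˣ where
  toFun := invOneSub
  invFun x := invOneSub (invOneSub x)
  left_inv := invOneSub_cube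
  right_inv := invOneSub_cube

theorem isNearGroupPerm_invOneSubPerm : IsNearGroupPerm (invOneSubPerm F) := by
  refine ⟨invOneSub_one, invOneSub_cube, fun x hx => ?_, fun s t hs ht hst => ?_⟩
  · change (invOneSub x)⁻¹ = invOneSub (invOneSub x⁻¹)
    ext
    rw [val_inv_eq_inv_val, val_invOneSub hx, val_invOneSub_invOneSub (inv_ne_one.mpr hx),
      val_inv_eq_inv_val, inv_inv, inv_inv]
  · change invOneSub (s * t) = invOneSub t * invOneSub ((invOneSub s)⁻¹ * invOneSub t⁻¹)
    have ht' : t⁻¹ ≠ 1 := inv_ne_one.mpr ht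
    have h1 : (invOneSub s)⁻¹ * invOneSub t⁻¹ ≠ 1 := by
      rw [Ne, _root_.inv_mul_eq_one]
      exact fun h => hst ((invOneSubPerm F).injective h)
    have h2 : s * t ≠ 1 := fun h => hst (eq_inv_of_mul_eq_one_left h)
    have h3 := one_sub_val_ne_zero ht'
    have h4 := t.ne_zero
    ext
    rw [val_mul, val_invOneSub h1, val_invOneSub h2, val_invOneSub ht, ← _root_.mul_inv,
      _root_.inv_inj]
    rw [val_mul, val_mul, val_inv_eq_inv_val, val_invOneSub hs, val_invOneSub ht',
      val_inv_eq_inv_val, inv_inv]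
    rw [val_inv_eq_inv_val] at h3
    have h5 : (1 - (t : F)) = - (t * (1 - (t : F)⁻¹)) := by
      field_simp
      ring
    rw [h5]
    have h6 : (t : F) * (t : F)⁻¹ = 1 := mul_inv_cancel₀ h4
    have h7 : (1 - (t : F)⁻¹) * (1 - (t : F)⁻¹)⁻¹ = 1 := mul_inv_cancel₀ h3
    linear_combination -(t * (1 - (s : F)) * h7) - h6

end Units

/-- **Theorem 6.1.** A finite abelian group `G` admits a near-group permutation
if and only if `G` is isomorphic to the multiplicative group of units of some finite
field; equivalently, if and only if there exist a prime `p` and a positive integer `α`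
such that `G` is cyclic of order `p ^ α - 1`. -/
theorem neargroup_perm_iff_units_of_finite_field (G : Type) [CommGroup G] [Finite G] :
    ((∃ π : Equiv.Perm G, IsNearGroupPerm π) ↔
      ∃ (F : Type) (_ : Field F) (_ : Fintype F), Nonempty (G ≃* Fˣ)) ∧
    ((∃ π : Equiv.Perm G, IsNearGroupPerm π) ↔
      ∃ p α : ℕ, p.Prime ∧ 0 < α ∧ IsCyclic G ∧ Nat.card G = p ^ α - 1) := by
  have perm_iff : (∃ π : Equiv.Perm G, IsNearGroupPerm π) ↔
      ∃ (F : Type) (_ : Field F) (_ : Fintype F), Nonempty (G ≃* Fˣ) := by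
    constructor
    · rintro ⟨π, h⟩
      obtain ⟨M, e, hM⟩ := h.exists_isOneSub
      have : Finite (WithZero G) := inferInstanceAs (Finite (Option G))
      exact ⟨WithZero G, hM.field, Fintype.ofFinite _, ⟨WithZero.unitsWithZeroEquiv.symm⟩⟩
    · rintro ⟨F, _, _, ⟨f⟩⟩
      exact ⟨_, Units.isNearGroupPerm_invOneSubPerm.conj f.symm⟩
  refine ⟨perm_iff, perm_iff.trans ⟨?_, ?_⟩⟩
  · rintro ⟨F, _, _, ⟨f⟩⟩
    obtain ⟨p, _⟩ := CharP.exists F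
    obtain ⟨n, hp, hn⟩ := FiniteField.card F p
    refine ⟨p, n, hp, n.pos, f.symm.isCyclic.mp inferInstance, ?_⟩
    rw [Nat.card_congr f.toEquiv, Nat.card_units, Nat.card_eq_fintype_card, hn]
  · rintro ⟨p, α, hp, hα, _, hcard⟩
    have : Fact p.Prime := ⟨hp⟩
    refine ⟨GaloisField p α, inferInstance, Fintype.ofFinite _, ⟨mulEquivOfCyclicCardEq ?_⟩⟩
    rw [hcard, Nat.card_units, GaloisField.card p α hα.ne']
end

section
/- Let F be a finite field. The map π defined by π(x) = (1 − x)⁻¹ is a bijection of the set {x ∈ F : x ≠ 0 and x ≠ 1} (the nonidentity elements of the multiplicative group Fˣ) onto itself, and it is a near-group permutation on Fˣ: it satisfies π ∘ π ∘ π = id, π(x)⁻¹ = π⁻¹(x⁻¹) for every x in the domain, and π(s·t) = π(t) · π(π(s)⁻¹ · π(t⁻¹)) for all s, t in the domain with s·t ≠ 1. -/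
open Classical in
/-- The map `x ↦ (1 - x)⁻¹` on the nonidentity units of a field, extended by fixing `1`. -/
noncomputable def oneSubInv {F : Type*} [Field F] (x : Fˣ) : Fˣ :=
  if h : x = 1 then 1
  else Units.mk0 (1 - (x : F))⁻¹
    (inv_ne_zero (sub_ne_zero.2 fun h' => h (Units.ext h'.symm)))

section

variable {F : Type*} [Field F]

@[simp]
theorem oneSubInv_one : oneSubInv (1 : Fˣ) = 1 := by
  simp [oneSubInv]

theorem coe_oneSubInv {x : Fˣ} (hx : x ≠ 1) :
    (oneSubInv x : F) = (1 - (x : F))⁻¹ := by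
  simp [oneSubInv, hx]

theorem one_sub_coe_ne_zero {x : Fˣ} (hx : x ≠ 1) : 1 - (x : F) ≠ 0 :=
  sub_ne_zero.2 fun h => hx (Units.ext h.symm)

theorem oneSubInv_ne_one {x : Fˣ} (hx : x ≠ 1) : oneSubInv x ≠ 1 := by
  intro h
  have h' := congrArg (Units.val : Fˣ → F) h
  rw [coe_oneSubInv hx, Units.val_one, inv_eq_one] at h'
  exact x.ne_zero (by linear_combination -h')

theorem coe_oneSubInv_oneSubInv {x : Fˣ} (hx : x ≠ 1) :
    (oneSubInv (oneSubInv x) : F) = 1 - (x : F)⁻¹ := by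
  have h0 := x.ne_zero
  have h1 := one_sub_coe_ne_zero hx
  rw [coe_oneSubInv (oneSubInv_ne_one hx), coe_oneSubInv hx]
  apply inv_eq_of_mul_eq_one_right
  field_simp
  ring

theorem oneSubInv_iterate_three (x : Fˣ) :
    oneSubInv (oneSubInv (oneSubInv x)) = x := by
  by_cases hx : x = 1
  · simp [hx]
  · ext
    rw [coe_oneSubInv (oneSubInv_ne_one (oneSubInv_ne_one hx)), coe_oneSubInv_oneSubInv hx]
    simp

theorem inv_oneSubInv {x : Fˣ} (hx : x ≠ 1) :
    (oneSubInv x)⁻¹ = oneSubInv (oneSubInv x⁻¹) := by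
  ext
  rw [coe_oneSubInv_oneSubInv (inv_ne_one.2 hx), Units.val_inv_eq_inv_val, coe_oneSubInv hx]
  simp

theorem oneSubInv_mul {s t : Fˣ} (hs : s ≠ 1) (ht : t ≠ 1) (hst : s ≠ t⁻¹) :
    oneSubInv (s * t) = oneSubInv t * oneSubInv ((oneSubInv s)⁻¹ * oneSubInv t⁻¹) := by
  have hst' : s * t ≠ 1 := fun h => hst (eq_inv_of_mul_eq_one_left h)
  have h0 := t.ne_zero
  have h1 := one_sub_coe_ne_zero ht
  have h2 := one_sub_coe_ne_zero hst'
  have harg : (((oneSubInv s)⁻¹ * oneSubInv t⁻¹ : Fˣ) : F)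
      = 1 - (1 - (s : F) * t) / (1 - t) := by
    have h3 := one_sub_coe_ne_zero (inv_ne_one.2 ht)
    rw [Units.val_mul, Units.val_inv_eq_inv_val, coe_oneSubInv hs,
      coe_oneSubInv (inv_ne_one.2 ht), inv_inv, ← div_eq_mul_inv, div_eq_iff h3,
      Units.val_inv_eq_inv_val]
    field_simp
    ring
  rw [Units.val_mul] at h2
  have hne : (oneSubInv s)⁻¹ * oneSubInv t⁻¹ ≠ 1 := by
    intro h
    rw [h, Units.val_one] at harg
    exact div_ne_zero h2 h1 (by linear_combination harg)
  ext
  rw [Units.val_mul, coe_oneSubInv hst', coe_oneSubInv ht, coe_oneSubInv hne, harg,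
    Units.val_mul, sub_sub_cancel, inv_div]
  field_simp

end

/-- For a finite field `F`, the map `x ↦ (1 - x)⁻¹` is a bijection of the set of
nonidentity elements of `Fˣ` onto itself, and (extended by fixing `1`) it is a
near-group permutation on `Fˣ`. -/
theorem isNearGroupPerm_one_sub_inv (F : Type*) [Field F] [Fintype F] :
    ∃ π : Equiv.Perm Fˣ, IsNearGroupPerm π ∧
      ∀ x : Fˣ, x ≠ 1 → ((π x : Fˣ) : F) = (1 - (x : F))⁻¹ :=
  ⟨⟨oneSubInv, fun x => oneSubInv (oneSubInv x), oneSubInv_iterate_three,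
      oneSubInv_iterate_three⟩,
    ⟨oneSubInv_one, oneSubInv_iterate_three, fun _ => inv_oneSubInv, fun _ _ => oneSubInv_mul⟩,
    fun _ => coe_oneSubInv⟩
end

section
/- If π is a near-group permutation on a finite abelian group G, then there exists an element ω ∈ G such that s · π(s) · π⁻¹(s) = ω for every nonidentity s ∈ G, and moreover ω² = 1. (Lemma 6.2 of the paper.) -/
namespace IsNearGroupPerm

/-- The product of an element with its image and its preimage under `π`. -/
def orbitProd {G : Type*} [CommGroup G] (π : Equiv.Perm G) (s : G) : G :=
  s * π s * π.symm s

variable {G : Type*} [CommGroup G] {π : Equiv.Perm G}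

lemma apply_inv (hπ : IsNearGroupPerm π) {x : G} (hx : x ≠ 1) : π x⁻¹ = (π.symm x)⁻¹ := by
  have h := hπ.2.2.1 x⁻¹ (inv_ne_one.mpr hx)
  rw [inv_inv] at h
  rw [← h, inv_inv]

lemma symm_inv (hπ : IsNearGroupPerm π) {x : G} (hx : x ≠ 1) : π.symm x⁻¹ = (π x)⁻¹ :=
  (hπ.2.2.1 x hx).symm

lemma apply_ne_one (hπ : IsNearGroupPerm π) {x : G} (hx : x ≠ 1) : π x ≠ 1 :=
  fun h => hx (π.injective (h.trans hπ.1.symm))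

lemma symm_ne_one (hπ : IsNearGroupPerm π) {x : G} (hx : x ≠ 1) : π.symm x ≠ 1 :=
  fun h => hx (by rw [← π.apply_symm_apply x, h, hπ.1])

lemma apply_apply (hπ : IsNearGroupPerm π) (x : G) : π (π x) = π.symm x := by
  rw [Equiv.eq_symm_apply, hπ.2.1]

lemma symm_symm_apply (hπ : IsNearGroupPerm π) (x : G) : π.symm (π.symm x) = π x := by
  rw [Equiv.symm_apply_eq, Equiv.symm_apply_eq, hπ.2.1]

lemma orbitProd_inv (hπ : IsNearGroupPerm π) {s : G} (hs : s ≠ 1) :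
    orbitProd π s⁻¹ = (orbitProd π s)⁻¹ := by
  simp only [orbitProd, hπ.apply_inv hs, hπ.symm_inv hs, mul_inv]
  exact mul_right_comm _ _ _

lemma orbitProd_apply (hπ : IsNearGroupPerm π) (s : G) :
    orbitProd π (π s) = orbitProd π s := by
  simp only [orbitProd, hπ.apply_apply, Equiv.symm_apply_apply]
  rw [mul_right_comm, mul_comm (π s) s]

lemma orbitProd_symm (hπ : IsNearGroupPerm π) (s : G) :
    orbitProd π (π.symm s) = orbitProd π s := by
  rw [← hπ.orbitProd_apply (π.symm s), Equiv.apply_symm_apply]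

lemma apply_mul_symm_ne_one (hπ : IsNearGroupPerm π) {s t : G} (ht : t ≠ 1)
    (hst : s * t ≠ 1) : π s * π.symm t ≠ 1 := by
  rw [Ne, mul_eq_one_iff_eq_inv, ← hπ.apply_inv ht, π.injective.eq_iff,
    ← mul_eq_one_iff_eq_inv]
  exact hst

lemma orbitProd_mul_orbitProd (hπ : IsNearGroupPerm π) {s t : G} (hs : s ≠ 1) (ht : t ≠ 1)
    (hst : s * t ≠ 1) :
    orbitProd π (s * t) * orbitProd π (π s * π.symm t) = orbitProd π s * orbitProd π t := by
  have hw := hπ.apply_mul_symm_ne_one ht hst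
  have h₁ : π (s * t) = π t * (π.symm (π s * π.symm t))⁻¹ := by
    rw [hπ.2.2.2 s t hs ht (by rwa [Ne, ← mul_eq_one_iff_eq_inv]), hπ.apply_inv ht, ← mul_inv,
      hπ.apply_inv hw]
  have h₂ : π.symm (s * t) = π.symm s * (π (π s * π.symm t))⁻¹ := by
    have h := hπ.2.2.2 t⁻¹ s⁻¹ (inv_ne_one.mpr ht) (inv_ne_one.mpr hs) (by
      rwa [inv_inv, Ne, eq_comm, ← mul_eq_one_iff_eq_inv])
    rw [← mul_inv, mul_comm t s, hπ.apply_inv hst, hπ.apply_inv ht, hπ.apply_inv hs, inv_inv,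
      inv_inv, mul_comm (π.symm t)] at h
    rw [← inv_inv (π.symm (s * t)), h, mul_inv, inv_inv]
  generalize hw' : π s * π.symm t = w at *
  simp only [orbitProd, h₁, h₂]
  rw [show s * π s * π.symm s * (t * π t * π.symm t)
    = s * t * π t * π.symm s * (π s * π.symm t) by ac_rfl, hw',
    show s * t * (π t * (π.symm w)⁻¹) * (π.symm s * (π w)⁻¹) * (w * π w * π.symm w)
    = s * t * π t * π.symm s * w * ((π.symm w)⁻¹ * π.symm w) * ((π w)⁻¹ * π w) by ac_rfl]
  simp

lemma orbitProd_mul_sq (hπ : IsNearGroupPerm π) {s t : G} (hs : s ≠ 1) (ht : t ≠ 1)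
    (hst : s * t ≠ 1) : orbitProd π (s * t) ^ 2 = orbitProd π s * orbitProd π t := by
  have hs' := hπ.apply_ne_one hs
  have ht' := hπ.symm_ne_one ht
  have hst' := hπ.apply_mul_symm_ne_one ht hst
  have h₀ := hπ.orbitProd_mul_orbitProd hs ht hst
  have h₁ := hπ.orbitProd_mul_orbitProd hs' ht' hst'
  have h₂ := hπ.orbitProd_mul_orbitProd (hπ.apply_ne_one hs') (hπ.symm_ne_one ht')
    (hπ.apply_mul_symm_ne_one ht' hst')
  simp only [hπ.orbitProd_apply, hπ.orbitProd_symm, hπ.2.1] at h₁ h₂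
  rw [hπ.symm_symm_apply t, Equiv.symm_apply_apply, mul_comm] at h₂
  have h₃ := mul_left_cancel (h₁.trans ((mul_comm _ _).trans h₀).symm)
  rw [hπ.symm_symm_apply] at h₃
  rw [← h₂, h₃, sq]

lemma orbitProd_mul (hπ : IsNearGroupPerm π) {s t : G} (hs : s ≠ 1) (ht : t ≠ 1)
    (hst : s * t ≠ 1) : orbitProd π (s * t) = orbitProd π s ^ 2 * orbitProd π t := by
  have h := hπ.orbitProd_mul_sq hst (inv_ne_one.mpr ht) (by rwa [mul_inv_cancel_right])
  rw [mul_inv_cancel_right, hπ.orbitProd_inv ht] at h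
  rw [h, inv_mul_cancel_right]

lemma orbitProd_eq_of_mul_ne_one (hπ : IsNearGroupPerm π) {s t : G} (hs : s ≠ 1) (ht : t ≠ 1)
    (hst : s * t ≠ 1) : orbitProd π s = orbitProd π t := by
  have h := hπ.orbitProd_mul hs ht hst
  rw [mul_comm s, hπ.orbitProd_mul ht hs (by rwa [mul_comm]), sq, sq,
    mul_comm (_ * _) (orbitProd π s), ← mul_assoc] at h
  exact (mul_left_cancel (mul_right_cancel h)).symm

lemma orbitProd_inv_eq (hπ : IsNearGroupPerm π) {s : G} (hs : s ≠ 1) :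
    orbitProd π s⁻¹ = orbitProd π s := by
  by_cases hss : s * s = 1
  · rw [← eq_inv_of_mul_eq_one_left hss]
  by_cases hr : ∃ r : G, r ≠ 1 ∧ r ≠ s ∧ r ≠ s⁻¹
  · obtain ⟨r, hr₁, hrs, hrs'⟩ := hr
    rw [hπ.orbitProd_eq_of_mul_ne_one (inv_ne_one.mpr hs) hr₁
        (by rwa [Ne, inv_mul_eq_one, eq_comm]),
      hπ.orbitProd_eq_of_mul_ne_one hr₁ hs (by rwa [Ne, mul_eq_one_iff_eq_inv])]
  · push Not at hr
    have h₂ : s * s = s⁻¹ := hr _ hss (by simpa using hs)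
    have h₃ : π s = s ∨ π s = s⁻¹ := by
      by_contra! h
      exact h.2 (hr _ (hπ.apply_ne_one hs) h.1)
    have h₄ : π s = s := by
      refine h₃.elim id fun h => ?_
      have h₅ := hπ.apply_inv hs
      rw [← h, hπ.apply_apply, eq_inv_iff_mul_eq_one] at h₅
      rcases eq_or_ne (π.symm s) s with h' | h'
      · exact absurd (h' ▸ h₅) hss
      · have h₇ := hr _ (hπ.symm_ne_one hs) h'
        rw [h₇, ← mul_inv, inv_eq_one] at h₅
        exact absurd h₅ hss
    have h₅ : orbitProd π s = 1 := by
      rw [orbitProd, π.symm_apply_eq.mpr h₄.symm, h₄, h₂, inv_mul_cancel]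
    rw [hπ.orbitProd_inv hs, h₅, inv_one]

end IsNearGroupPerm

/-- **Lemma 6.2.** If `π` is a near-group permutation on a finite abelian group `G`,
then there is an element `ω ∈ G` with `s · π(s) · π⁻¹(s) = ω` for every nonidentity
`s ∈ G`, and moreover `ω² = 1`. -/
theorem exists_omega_of_isNearGroupPerm {G : Type*} [CommGroup G] [Finite G]
    (π : Equiv.Perm G) (hπ : IsNearGroupPerm π) :
    ∃ ω : G, (∀ s : G, s ≠ 1 → s * π s * π.symm s = ω) ∧ ω ^ 2 = 1 := by
  by_cases h : ∃ s : G, s ≠ 1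
  · obtain ⟨s, hs⟩ := h
    refine ⟨IsNearGroupPerm.orbitProd π s, fun t ht => ?_, ?_⟩
    · change IsNearGroupPerm.orbitProd π t = _
      by_cases hts : t * s = 1
      · rw [eq_inv_of_mul_eq_one_left hts, hπ.orbitProd_inv_eq hs]
      · exact hπ.orbitProd_eq_of_mul_ne_one ht hs hts
    · rw [sq, mul_eq_one_iff_eq_inv, ← hπ.orbitProd_inv hs, hπ.orbitProd_inv_eq hs]
  · exact ⟨1, fun s hs => absurd ⟨s, hs⟩ h, one_pow 2⟩
end

section
/- Let π be a near-group permutation on a finite abelian group G and let ω ∈ G satisfy s · π(s) · π⁻¹(s) = ω for every nonidentity s ∈ G. Then for all nonidentity a, b ∈ G with b ≠ ω·a one has π(ω·b·a⁻¹)⁻¹ · a = π(ω·a·b⁻¹)⁻¹ · b. (This is the commutativity of the addition a + b := π(ω·b·a⁻¹)⁻¹ · a in the field constructed in the proof of Theorem 6.1.) -/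
theorem IsNearGroupPerm.apply_inv_s3 {G : Type*} [Group G] {π : Equiv.Perm G}
    (hπ : IsNearGroupPerm π) {x : G} (hx : x ≠ 1) : π x⁻¹ = (π.symm x)⁻¹ := by
  have h := hπ.2.2.1 x⁻¹ (inv_ne_one.mpr hx)
  rw [inv_inv] at h
  rw [← h, inv_inv]

theorem IsNearGroupPerm.inv_eq_self {G : Type*} [CommGroup G] {π : Equiv.Perm G}
    (hπ : IsNearGroupPerm π) {ω x : G} (hx : x ≠ 1)
    (hω : ∀ s : G, s ≠ 1 → s * π s * π.symm s = ω) : ω⁻¹ = ω := by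
  have h := hω x⁻¹ (inv_ne_one.mpr hx)
  rw [hπ.apply_inv_s3 hx, ← hπ.2.2.1 x hx] at h
  calc ω⁻¹ = (x * π x * π.symm x)⁻¹ := by rw [hω x hx]
    _ = x⁻¹ * (π.symm x)⁻¹ * (π x)⁻¹ := by simp only [mul_inv, mul_right_comm]
    _ = ω := h

/-- Commutativity of the addition `a + b := π(ω·b·a⁻¹)⁻¹ · a` in the field constructed
in the proof of Theorem 6.1. -/
theorem neargroup_add_comm {G : Type*} [CommGroup G] [Finite G]
    (π : Equiv.Perm G) (hπ : IsNearGroupPerm π) (ω : G)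
    (hω : ∀ s : G, s ≠ 1 → s * π s * π.symm s = ω) :
    ∀ a b : G, a ≠ 1 → b ≠ 1 → b ≠ ω * a →
      (π (ω * b * a⁻¹))⁻¹ * a = (π (ω * a * b⁻¹))⁻¹ * b := by
  intro a b ha _ hab
  have hinv : ω⁻¹ = ω := hπ.inv_eq_self ha hω
  have hu : ω * b * a⁻¹ ≠ 1 := by
    intro h
    apply hab
    rw [mul_inv_eq_one] at h
    rw [← h, ← mul_assoc]
    nth_rewrite 1 [← hinv]
    simp
  have hsymm : ω * a * b⁻¹ = (ω * b * a⁻¹)⁻¹ := by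
    simp [hinv, mul_assoc, mul_comm]
  rw [hsymm, hπ.apply_inv_s3 hu, inv_inv, inv_mul_eq_iff_eq_mul]
  have h := hω _ hu
  have h' : ω * (b * a⁻¹ * π (ω * b * a⁻¹) * π.symm (ω * b * a⁻¹)) = ω * 1 := by
    rw [mul_one]
    nth_rewrite 4 [← h]
    simp only [mul_assoc]
  have h1 := mul_left_cancel h'
  rw [mul_assoc, mul_assoc, ← mul_assoc, ← div_eq_mul_inv, div_mul_eq_mul_div,
    div_eq_one] at h1
  exact h1.symm.trans ((mul_comm _ _).trans (mul_assoc _ _ _))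
end

section
/- Let π be a near-group permutation on a finite abelian group G. Then for all nonidentity s, t ∈ G with s ≠ t⁻¹ one has π(s·t) = π(t) · s⁻¹ · π⁻¹(t) · π(s⁻¹·t⁻¹). (This is the iterated product expansion derived in the proof of Lemma 6.2.) -/
/-- The iterated product expansion derived in the proof of Lemma 6.2:
`π(s·t) = π(t) · s⁻¹ · π⁻¹(t) · π(s⁻¹·t⁻¹)` for all nonidentity `s, t` with `s ≠ t⁻¹`. -/
theorem neargroup_iterated_expansion {G : Type*} [CommGroup G] [Finite G]
    (π : Equiv.Perm G) (hπ : IsNearGroupPerm π) :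
    ∀ s t : G, s ≠ 1 → t ≠ 1 → s ≠ t⁻¹ →
      π (s * t) = π t * s⁻¹ * π.symm t * π (s⁻¹ * t⁻¹) := by
  obtain ⟨h1, h3, hinv, hmul⟩ := hπ
  have symm_eq : ∀ x, π.symm x = π (π x) := fun x => by
    rw [Equiv.symm_apply_eq, h3]
  have ne_one : ∀ x, x ≠ 1 → π x ≠ 1 := fun x hx h =>
    hx (π.injective (h.trans h1.symm))
  have map_inv_map : ∀ x, x ≠ 1 → π (π x)⁻¹ = x⁻¹ := fun x hx => by
    rw [hinv x hx, Equiv.apply_symm_apply]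
  have inv_map : ∀ x, x ≠ 1 → (π x)⁻¹ = π (π x⁻¹) := fun x hx => by
    rw [hinv x hx, symm_eq]
  intro s t hs ht hst
  have first := hmul s t hs ht hst
  have second := hmul (π t⁻¹) (π s)⁻¹ (ne_one _ (inv_ne_one.2 ht))
    (inv_ne_one.2 (ne_one s hs)) (by
      rw [inv_inv]
      exact fun h => hst (π.injective h).symm)
  rw [map_inv_map s hs, ← inv_map t ht, inv_inv, inv_inv] at second
  have third := hmul (π (π s)) (π t) (ne_one _ (ne_one s hs)) (ne_one t ht) (by
    rw [inv_map t ht]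
    exact fun h => hst (π.injective (π.injective h)))
  rw [h3, map_inv_map t ht] at third
  rw [first, mul_comm (π s)⁻¹, second, mul_comm (π t) (π (π s)), third, symm_eq]
  simp only [mul_assoc]
end

section
/- Let G be a nontrivial finite abelian group, let π be a near-group permutation on G, and let ω ∈ G satisfy s · π(s) · π⁻¹(s) = ω for every nonidentity s ∈ G. Then ω = 1 if and only if the order of G is odd. -/
/-- For a nontrivial finite abelian group `G` with near-group permutation `π` and
associated constant `ω`, one has `ω = 1` if and only if the order of `G` is odd. -/
theorem neargroup_omega_eq_one_iff_odd_card {G : Type*} [CommGroup G] [Finite G]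
    [Nontrivial G] (π : Equiv.Perm G) (hπ : IsNearGroupPerm π) (ω : G)
    (hω : ∀ s : G, s ≠ 1 → s * π s * π.symm s = ω) :
    ω = 1 ↔ Odd (Nat.card G) := by
  obtain ⟨-, -, hinv, -⟩ := hπ
  constructor
  · intro hω1
    by_contra hodd
    rw [Nat.not_odd_iff_even, even_iff_two_dvd] at hodd
    have : Fact (Nat.Prime 2) := ⟨Nat.prime_two⟩
    obtain ⟨z, hz⟩ := exists_prime_orderOf_dvd_card' 2 hodd
    obtain ⟨hz2, hz1⟩ := orderOf_eq_prime_iff.mp hz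
    have hzi : z⁻¹ = z := inv_eq_of_mul_eq_one_left (by rw [← sq, hz2])
    have h := hω z hz1
    rw [← hzi, ← hinv z hz1, hzi, mul_inv_cancel_right, hω1] at h
    exact hz1 h
  · intro hodd
    obtain ⟨s, hs⟩ := exists_ne (1 : G)
    have hs' : s⁻¹ ≠ 1 := inv_ne_one.mpr hs
    have h₁ := hω s hs
    have h₂ := hω s⁻¹ hs'
    have h₃ := hinv s⁻¹ hs'
    rw [inv_inv] at h₃
    rw [← h₃] at h₁
    rw [← hinv s hs] at h₂
    have hsq : ω ^ 2 = 1 := by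
      rw [sq]
      nth_rewrite 1 [← h₁]
      rw [← h₂, mul_mul_mul_comm, mul_mul_mul_comm s, mul_inv_cancel, one_mul,
        mul_assoc, mul_inv_cancel_left, mul_inv_cancel]
    exact (Nat.Coprime.pow_left_bijective hodd.coprime_two_right).injective
      (by simpa using hsq)
end

section
/- If G is a group of order 3, then the only near-group permutation on G is the identity map on the two nonidentity elements of G. -/
/-- If `G` is a group of order 3, then the only near-group permutation on `G` is the
identity map on the two nonidentity elements of `G`. -/
theorem neargroup_perm_card_three_eq_id {G : Type*} [Group G] (hG : Nat.card G = 3)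
    (π : Equiv.Perm G) (hπ : IsNearGroupPerm π) :
    ∀ x : G, π x = x := by
  obtain ⟨h_one, h_cube, -, -⟩ := hπ
  intro x
  by_contra hx
  have hx1 : x ≠ 1 := by
    rintro rfl
    exact hx h_one
  have h_ne : ∀ y : G, y ≠ 1 → π y ≠ 1 := fun y hy h => hy (π.injective (h.trans h_one.symm))
  have hxx : π (π x) ≠ x := fun h => hx (by simpa [h] using h_cube x)
  have : Finite G := Nat.finite_of_card_ne_zero (by omega)
  have : Fintype G := Fintype.ofFinite G
  classical
  have h_card : ({1, x, π x, π (π x)} : Finset G).card = 4 := by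
    have h1 := h_ne x hx1
    have h2 := h_ne _ h1
    have h3 : π x ≠ π (π x) := fun h => hx (π.injective h).symm
    simp [hx1.symm, h1.symm, h2.symm, Ne.symm hx, hxx.symm, h3]
  have h_le := Finset.card_le_univ ({1, x, π x, π (π x)} : Finset G)
  rw [Nat.card_eq_fintype_card] at hG
  omega
end

section
/- Let F be a finite field and let 𝒢 be the affine group of F. Then for every element (b,a) ∈ 𝒢 with a ≠ 1, the conjugacy class of (b,a) in 𝒢 has exactly |F| elements. -/
/-- The affine group of a field `F`: the semidirect product of the additive group of
`F` by the multiplicative group `Fˣ`, with `Fˣ` acting by multiplication.  Elements are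
pairs `(b, a)` with `b ∈ F`, `a ∈ Fˣ`, and multiplication
`(b, a) · (b', a') = (b + a·b', a·a')`. -/
@[ext]
structure AffGroup (F : Type*) [Field F] where
  /-- The translation part. -/
  b : F
  /-- The scaling part. -/
  a : Fˣ

namespace AffGroup

variable {F : Type*} [Field F]

instance : Mul (AffGroup F) := ⟨fun x y => ⟨x.b + (x.a : F) * y.b, x.a * y.a⟩⟩
instance : One (AffGroup F) := ⟨⟨0, 1⟩⟩
instance : Inv (AffGroup F) := ⟨fun x => ⟨-((x.a⁻¹ : Fˣ) * x.b : F), x.a⁻¹⟩⟩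

@[simp] theorem mul_b (x y : AffGroup F) : (x * y).b = x.b + (x.a : F) * y.b := rfl
@[simp] theorem mul_a (x y : AffGroup F) : (x * y).a = x.a * y.a := rfl
@[simp] theorem one_b : (1 : AffGroup F).b = 0 := rfl
@[simp] theorem one_a : (1 : AffGroup F).a = 1 := rfl
@[simp] theorem inv_b (x : AffGroup F) : (x⁻¹).b = -((x.a⁻¹ : Fˣ) * x.b : F) := rfl
@[simp] theorem inv_a (x : AffGroup F) : (x⁻¹).a = x.a⁻¹ := rfl

instance : Group (AffGroup F) where
  mul_assoc x y z := by ext <;> simp [mul_add, mul_assoc, add_assoc]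
  one_mul x := by ext <;> simp
  mul_one x := by ext <;> simp
  inv_mul_cancel x := by ext <;> simp

/-- The projection homomorphism `(b, a) ↦ a` from the affine group of `F` to `Fˣ`.
Its kernel is the translation subgroup `{(b, 1) : b ∈ F}`. -/
def proj : AffGroup F →* Fˣ where
  toFun x := x.a
  map_one' := rfl
  map_mul' _ _ := rfl

end AffGroup

/-- An element of the affine group whose scaling part is not `1` is conjugate exactly to
the elements with the same scaling part. -/
theorem AffGroup.isConj_iff_a_eq {F : Type*} [Field F] {x y : AffGroup F} (hx : x.a ≠ 1) :
    IsConj x y ↔ x.a = y.a := by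
  constructor
  · intro h
    exact isConj_iff_eq.mp (AffGroup.proj.map_isConj h)
  · intro h
    have hne : (1 : F) - (x.a : F) ≠ 0 :=
      sub_ne_zero.mpr fun e => hx (Units.ext e.symm)
    rw [isConj_iff]
    refine ⟨⟨(y.b - x.b) / (1 - (x.a : F)), 1⟩, ?_⟩
    rw [mul_inv_eq_iff_eq_mul]
    ext
    · simp only [AffGroup.mul_b, ← h, Units.val_one, one_mul]
      field_simp
      ring
    · simp [h]

/-- For a finite field `F`, the conjugacy class of any element `(b, a)` of the affine
group of `F` with `a ≠ 1` has exactly `|F|` elements. -/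
theorem AffGroup.card_conjClass_of_a_ne_one (F : Type*) [Field F] [Fintype F]
    (b : F) (a : Fˣ) (ha : a ≠ 1) :
    Nat.card {x : AffGroup F | IsConj (⟨b, a⟩ : AffGroup F) x} = Fintype.card F := by
  let e : {x : AffGroup F | IsConj (⟨b, a⟩ : AffGroup F) x} ≃ F :=
    { toFun := fun x => x.1.b
      invFun := fun c => ⟨⟨c, a⟩, (AffGroup.isConj_iff_a_eq ha).mpr rfl⟩
      left_inv := fun x =>
        Subtype.ext (AffGroup.ext rfl ((AffGroup.isConj_iff_a_eq (x := ⟨b, a⟩) ha).mp x.2))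
      right_inv := fun _ => rfl }
  rw [Nat.card_congr e, Nat.card_eq_fintype_card]
end

section
/- Let F be a finite field and let 𝒢 be the affine group of F. Then the number of conjugacy classes of 𝒢 equals the cardinality of F. -/
namespace AffGroup

variable {F : Type*} [Field F]

theorem isConj_iff_exists {x y : AffGroup F} :
    IsConj x y ↔ x.a = y.a ∧ ∃ (d : F) (e : Fˣ), d + e * x.b = y.b + y.a * d := by
  rw [isConj_iff]
  simp_rw [mul_inv_eq_iff_eq_mul]
  constructor
  · rintro ⟨c, h⟩
    have ha : c.a * x.a = y.a * c.a := congrArg AffGroup.a h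
    rw [mul_comm] at ha
    exact ⟨mul_right_cancel ha, c.b, c.a, congrArg AffGroup.b h⟩
  · rintro ⟨ha, d, e, h⟩
    refine ⟨⟨d, e⟩, AffGroup.ext h ?_⟩
    simp [ha, mul_comm]

open Classical in
/-- The conjugacy class of the scaling by `x` for `x ≠ 0`, and the class of the nontrivial
translations for `x = 0`. -/
noncomputable def toConjClasses (x : F) : ConjClasses (AffGroup F) :=
  if h : x = 0 then ConjClasses.mk ⟨1, 1⟩ else ConjClasses.mk ⟨0, Units.mk0 x h⟩

@[simp]
theorem toConjClasses_zero : toConjClasses (0 : F) = ConjClasses.mk ⟨1, 1⟩ :=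
  dif_pos rfl

@[simp]
theorem toConjClasses_unit (u : Fˣ) : toConjClasses (u : F) = ConjClasses.mk ⟨0, u⟩ := by
  simp [toConjClasses]

theorem not_isConj_translation_scaling (u : Fˣ) :
    ¬ IsConj (⟨1, 1⟩ : AffGroup F) ⟨0, u⟩ := by
  rw [isConj_iff_exists]
  rintro ⟨rfl, d, e, h⟩
  simp at h

theorem toConjClasses_injective : Function.Injective (toConjClasses (F := F)) := by
  intro x y h
  rcases GroupWithZero.eq_zero_or_unit x with rfl | ⟨u, rfl⟩ <;>
    rcases GroupWithZero.eq_zero_or_unit y with rfl | ⟨v, rfl⟩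
  · rfl
  · rw [toConjClasses_zero, toConjClasses_unit, ConjClasses.mk_eq_mk_iff_isConj] at h
    exact absurd h (not_isConj_translation_scaling v)
  · rw [toConjClasses_zero, toConjClasses_unit, ConjClasses.mk_eq_mk_iff_isConj] at h
    exact absurd h.symm (not_isConj_translation_scaling u)
  · rw [toConjClasses_unit, toConjClasses_unit, ConjClasses.mk_eq_mk_iff_isConj,
      isConj_iff_exists] at h
    exact congrArg Units.val h.1

theorem toConjClasses_surjective : Function.Surjective (toConjClasses (F := F)) := by
  intro c
  obtain ⟨⟨b, a⟩, rfl⟩ := ConjClasses.exists_rep c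
  by_cases ha : a = 1
  · subst ha
    rcases GroupWithZero.eq_zero_or_unit b with rfl | ⟨u, rfl⟩
    · exact ⟨((1 : Fˣ) : F), toConjClasses_unit 1⟩
    · refine ⟨0, ?_⟩
      rw [toConjClasses_zero, ConjClasses.mk_eq_mk_iff_isConj, isConj_iff_exists]
      exact ⟨rfl, 0, u, by simp⟩
  · refine ⟨a, ?_⟩
    rw [toConjClasses_unit, ConjClasses.mk_eq_mk_iff_isConj, isConj_iff_exists]
    have h : (1 : F) - a ≠ 0 := fun h => ha (Units.ext (sub_eq_zero.mp h).symm)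
    refine ⟨rfl, b / (1 - a), 1, ?_⟩
    field_simp
    ring

end AffGroup

/-- For a finite field `F`, the number of conjugacy classes of the affine group of `F`
equals the cardinality of `F`. -/
theorem AffGroup.card_conjClasses (F : Type*) [Field F] [Fintype F] :
    Nat.card (ConjClasses (AffGroup F)) = Fintype.card F := by
  rw [← Nat.card_eq_fintype_card]
  exact (Nat.card_eq_of_bijective toConjClasses
    ⟨toConjClasses_injective, toConjClasses_surjective⟩).symm
end

section
/- Let F be a finite field and let 𝒢 be the affine group of F. Then 𝒢 has an irreducible finite-dimensional complex representation of dimension |F| − 1. -/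
namespace AffGroup

variable {F : Type} [Field F]

instance [Finite F] : Finite (AffGroup F) :=
  Finite.of_injective (fun g => (g.b, g.a)) fun _ _ h =>
    AffGroup.ext (congrArg Prod.fst h) (congrArg Prod.snd h)

/-- The representation of the affine group on functions `Fˣ → ℂ` attached to an additive
character `ψ`: the element `(b, a)` sends `f` to `x ↦ ψ (x b) f (x a)`. -/
def unitsRep (ψ : AddChar F ℂ) : Representation ℂ (AffGroup F) (Fˣ → ℂ) where
  toFun g :=
    { toFun := fun f x => ψ (x * g.b) * f (x * g.a)
      map_add' := fun f f' => by ext x; simp [mul_add]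
      map_smul' := fun c f => by ext x; simp [mul_left_comm] }
  map_one' := by ext; simp
  map_mul' g h := by
    refine LinearMap.ext fun f => funext fun x => ?_
    simp [mul_add, AddChar.map_add_eq_mul, mul_assoc]

@[simp]
theorem unitsRep_apply (ψ : AddChar F ℂ) (g : AffGroup F) (f : Fˣ → ℂ) (x : Fˣ) :
    unitsRep ψ g f x = ψ (x * g.b) * f (x * g.a) := rfl

/-- A linear endomorphism commuting with `unitsRep ψ`, for `ψ` primitive, is a scalar. -/
theorem eq_smul_id_of_commute_unitsRep [Finite F] {ψ : AddChar F ℂ} (hψ : ψ.IsPrimitive)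
    (T : (Fˣ → ℂ) →ₗ[ℂ] (Fˣ → ℂ)) (hT : ∀ g f, T (unitsRep ψ g f) = unitsRep ψ g (T f)) :
    ∃ c : ℂ, T = c • LinearMap.id := by
  classical
  have off_diag (x y : Fˣ) (hxy : y ≠ x) : T (Pi.single x 1) y = 0 := by
    have hne : (y : F) - x ≠ 0 := sub_ne_zero.2 fun h => hxy (Units.ext h)
    obtain ⟨b, hb⟩ := AddChar.ne_one_iff.1 (hψ hne)
    rw [AddChar.mulShift_apply, sub_mul, AddChar.map_sub_eq_div] at hb
    have h1 : unitsRep ψ ⟨b, 1⟩ (Pi.single x 1) = ψ (x * b) • (Pi.single x 1 : Fˣ → ℂ) := by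
      ext z
      by_cases hz : z = x
      · subst hz; simp
      · simp [hz]
    have h2 := congrFun (hT ⟨b, 1⟩ (Pi.single x 1)) y
    rw [h1, map_smul] at h2
    simp only [Pi.smul_apply, smul_eq_mul, unitsRep_apply, mul_one] at h2
    by_contra h0
    exact hb (by rw [mul_right_cancel₀ h0 h2, div_self (ψ.val_isUnit _).ne_zero])
  have diag (x : Fˣ) : T (Pi.single x 1) x = T (Pi.single 1 1) 1 := by
    have h1 : unitsRep ψ ⟨0, x⁻¹⟩ (Pi.single 1 1) = (Pi.single x 1 : Fˣ → ℂ) := by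
      ext z
      simp [Pi.single_apply, mul_inv_eq_one]
    rw [← h1, hT]
    simp
  refine ⟨T (Pi.single 1 1) 1, LinearMap.pi_ext' fun x => LinearMap.ext_ring <| funext fun y => ?_⟩
  by_cases hxy : y = x
  · subst hxy; simp [diag]
  · simp [off_diag x y hxy, hxy]

theorem simple_of_unitsRep [Finite F] {ψ : AddChar F ℂ} (hψ : ψ.IsPrimitive) :
    CategoryTheory.Simple (FDRep.of (unitsRep ψ)) := by
  have : NeZero (Nat.card (AffGroup F) : ℂ) := ⟨Nat.cast_ne_zero.2 Nat.card_pos.ne'⟩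
  rw [FDRep.simple_iff_end_is_rank_one]
  refine finrank_eq_one (CategoryTheory.CategoryStruct.id _) (fun h => ?_) fun f => ?_
  · have := congrArg (fun f : FDRep.of (unitsRep ψ) ⟶ FDRep.of (unitsRep ψ) =>
      f.hom.hom.hom (fun _ => (1 : ℂ)) 1) h
    exact one_ne_zero this
  · obtain ⟨c, hc⟩ := eq_smul_id_of_commute_unitsRep hψ f.hom.hom.hom fun g v =>
      congrArg (fun k => k.hom.hom v) (f.comm g)
    refine ⟨c, ?_⟩
    ext v : 3
    exact (LinearMap.congr_fun hc v).symm

end AffGroup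

/-- For a finite field `F`, the affine group of `F` has an irreducible
finite-dimensional complex representation of dimension `|F| − 1`. -/
theorem AffGroup.exists_simple_fdRep_finrank (F : Type) [Field F] [Fintype F] :
    ∃ V : FDRep ℂ (AffGroup F), CategoryTheory.Simple V ∧
      Module.finrank ℂ V = Fintype.card F - 1 := by
  classical
  obtain ⟨ψ, hψ⟩ : ∃ ψ : AddChar F ℂ, ψ.IsPrimitive := by
    exact ⟨_, AddChar.FiniteField.primitiveChar_to_Complex_isPrimitive F⟩
  refine ⟨FDRep.of (unitsRep ψ), simple_of_unitsRep hψ, ?_⟩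
  rw [← Fintype.card_units]
  exact Module.finrank_fintype_fun_eq_card ℂ
end

section
/- Let F be a finite field and let 𝒢 be the affine group of F. Then every irreducible finite-dimensional complex representation of 𝒢 has dimension either 1 or |F| − 1. -/
namespace FDRep

open CategoryTheory in
/-- A nonzero subrepresentation of a simple object of `FDRep k G` is everything. -/
theorem toSubmodule_eq_top_of_simple {k : Type*} {G : Type*} [Field k] [Monoid G]
    (V : FDRep k G) [Simple V] (σ : Subrepresentation V.ρ) (hσ : σ.toSubmodule ≠ ⊥) :
    σ.toSubmodule = ⊤ := by
  let f : FDRep.of σ.toRepresentation ⟶ V :=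
    ⟨FGModuleCat.ofHom σ.toSubmodule.subtype, fun _ ↦ rfl⟩
  have : Mono f := ConcreteCategory.mono_of_injective f Subtype.val_injective
  have hf0 : f ≠ 0 := by
    intro h
    refine hσ ((Submodule.eq_bot_iff _).2 fun x hx ↦ ?_)
    have h' : f.hom.hom.hom = 0 := by rw [h]; rfl
    exact LinearMap.congr_fun h' (⟨x, hx⟩ : σ.toSubmodule)
  have : IsIso f := isIso_of_mono_of_nonzero hf0
  refine Submodule.eq_top_iff'.2 fun v ↦ ?_
  obtain ⟨x, hx⟩ := (FDRep.isoToLinearEquiv (asIso f)).surjective v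
  rw [← hx]
  exact Subtype.prop (p := (· ∈ σ.toSubmodule)) x

/-- The underlying space of a simple object of `FDRep k G` is nontrivial. -/
theorem nontrivial_of_simple {k : Type*} {G : Type*} [Field k] [Monoid G]
    (V : FDRep k G) [CategoryTheory.Simple V] : Nontrivial V := by
  by_contra h
  rw [not_nontrivial_iff_subsingleton] at h
  refine CategoryTheory.id_nonzero V ?_
  ext v
  exact Subsingleton.elim (α := V) _ _

end FDRep

namespace AffGroup

variable {F : Type*} [Field F] {V : Type*} [AddCommGroup V] [Module ℂ V]

/-- The vectors on which the translation by `b` acts as the scalar `ψ (c * b)`, for all `b`. -/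
def weightSpace (ρ : Representation ℂ (AffGroup F) V) (ψ : AddChar F ℂ) (c : F) :
    Submodule ℂ V where
  carrier := {v | ∀ b, ρ ⟨b, 1⟩ v = ψ (c * b) • v}
  add_mem' hv hw b := by rw [map_add, hv b, hw b, smul_add]
  zero_mem' b := by simp
  smul_mem' r v hv b := by rw [map_smul, hv b, smul_comm]

variable {ρ : Representation ℂ (AffGroup F) V} {ψ : AddChar F ℂ}

theorem mk_eq_mul (b : F) (a : Fˣ) : (⟨b, a⟩ : AffGroup F) = ⟨b, 1⟩ * ⟨0, a⟩ := by
  ext <;> simp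

theorem scaling_mem_weightSpace {c : F} {v : V} (hv : v ∈ weightSpace ρ ψ c) (a : Fˣ) :
    ρ ⟨0, a⟩ v ∈ weightSpace ρ ψ (c * (a⁻¹ : Fˣ)) := by
  intro b
  have h : (⟨b, 1⟩ * ⟨0, a⟩ : AffGroup F) = ⟨0, a⟩ * ⟨(a⁻¹ : Fˣ) * b, 1⟩ := by
    ext <;> simp
  rw [← Module.End.mul_apply, ← map_mul, h, map_mul, Module.End.mul_apply, hv, map_smul,
    mul_assoc]

/-- The span of the orbit of a weight vector under the scalings, as a subrepresentation. -/
def spanScaling {c : F} {v : V} (hv : v ∈ weightSpace ρ ψ c) : Subrepresentation ρ where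
  toSubmodule := Submodule.span ℂ (Set.range fun a : Fˣ ↦ ρ ⟨0, a⟩ v)
  apply_mem_toSubmodule g w hw := by
    refine (Submodule.span_le (p := (Submodule.span ℂ _).comap (ρ g))).2 ?_ hw
    rintro _ ⟨a, rfl⟩
    have h : (g * ⟨0, a⟩ : AffGroup F) = ⟨g.b, 1⟩ * ⟨0, g.a * a⟩ := by ext <;> simp
    rw [SetLike.mem_coe, Submodule.mem_comap, ← Module.End.mul_apply, ← map_mul, h, map_mul,
      Module.End.mul_apply, scaling_mem_weightSpace hv]
    exact Submodule.smul_mem _ _ (Submodule.subset_span ⟨_, rfl⟩)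

/-- The space of translation-invariant vectors, as a subrepresentation. -/
def weightSpaceZero (ρ : Representation ℂ (AffGroup F) V) (ψ : AddChar F ℂ) :
    Subrepresentation ρ where
  toSubmodule := weightSpace ρ ψ 0
  apply_mem_toSubmodule g v hv := by
    rw [show g = ⟨g.b, 1⟩ * ⟨0, g.a⟩ from mk_eq_mul g.b g.a, map_mul, Module.End.mul_apply]
    have h := scaling_mem_weightSpace hv g.a
    rw [zero_mul] at h
    rw [h]
    exact Submodule.smul_mem _ _ h

/-- If the translations act trivially, an eigenvector of the scaling by a generator of `Fˣ`
spans a subrepresentation. -/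
def spanEigenvector [Finite F] (hρ : weightSpace ρ ψ 0 = ⊤) {a : Fˣ}
    (ha : ∀ x, x ∈ Subgroup.zpowers a)
    {μ : ℂ} {v : V} (hv : ρ ⟨0, a⟩ v = μ • v) : Subrepresentation ρ where
  toSubmodule := ℂ ∙ v
  apply_mem_toSubmodule g w hw := by
    obtain ⟨n, hn⟩ := mem_powers_iff_mem_zpowers.2 (ha g.a)
    have hpow (n : ℕ) : (⟨0, a⟩ : AffGroup F) ^ n = ⟨0, a ^ n⟩ := by
      induction n with
      | zero => rw [pow_zero, pow_zero]; rfl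
      | succ n ih => rw [pow_succ, ih]; ext <;> simp [pow_succ]
    have htriv (b : F) (u : V) : ρ ⟨b, 1⟩ u = u := by
      have : u ∈ weightSpace ρ ψ 0 := hρ ▸ Submodule.mem_top
      simpa using this b
    rw [show g = ⟨g.b, 1⟩ * ⟨0, g.a⟩ from mk_eq_mul g.b g.a, map_mul, Module.End.mul_apply,
      htriv, ← hn]
    dsimp only
    rw [← hpow, map_pow]
    refine Module.End.pow_apply_mem_of_forall_mem n (fun u hu ↦ ?_) w hw
    obtain ⟨r, rfl⟩ := Submodule.mem_span_singleton.1 hu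
    rw [map_smul, hv]
    exact Submodule.smul_mem _ _ (Submodule.smul_mem _ _ (Submodule.mem_span_singleton_self v))

variable [Fintype F]

/-- The unnormalised projection onto `weightSpace ρ ψ c`. -/
noncomputable def weightProj (ρ : Representation ℂ (AffGroup F) V) (ψ : AddChar F ℂ) (c : F) :
    V →ₗ[ℂ] V :=
  ∑ b : F, ψ (-(c * b)) • ρ ⟨b, 1⟩

theorem weightProj_apply (c : F) (v : V) :
    weightProj ρ ψ c v = ∑ b : F, ψ (-(c * b)) • ρ ⟨b, 1⟩ v := by
  simp [weightProj]

theorem weightProj_mem (c : F) (v : V) : weightProj ρ ψ c v ∈ weightSpace ρ ψ c := by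
  intro d
  rw [weightProj_apply, map_sum, Finset.smul_sum]
  refine Fintype.sum_equiv (Equiv.addLeft d) _ _ fun b ↦ ?_
  have h : (⟨d, 1⟩ * ⟨b, 1⟩ : AffGroup F) = ⟨d + b, 1⟩ := by ext <;> simp
  rw [map_smul, ← Module.End.mul_apply, ← map_mul, h, smul_smul, ← AddChar.map_add_eq_mul,
    Equiv.coe_addLeft]
  congr 2
  ring

theorem weightProj_apply_of_mem [DecidableEq F] (hψ : ψ.IsPrimitive) {c : F} {v : V}
    (hv : v ∈ weightSpace ρ ψ c) (d : F) :
    weightProj ρ ψ d v = if c = d then (Fintype.card F : ℂ) • v else 0 := by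
  have h (b : F) : ψ (-(d * b)) • ρ ⟨b, 1⟩ v = ψ (b * (c - d)) • v := by
    rw [hv b, smul_smul, ← AddChar.map_add_eq_mul]
    congr 2
    ring
  simp_rw [weightProj_apply, h, ← Finset.sum_smul, AddChar.sum_mulShift _ hψ, sub_eq_zero]
  split_ifs <;> simp

theorem sum_weightProj_apply (hψ : ψ.IsPrimitive) (v : V) :
    ∑ c : F, weightProj ρ ψ c v = (Fintype.card F : ℂ) • v := by
  classical
  simp_rw [weightProj_apply]
  rw [Finset.sum_comm]
  have h (c b : F) : -(c * b) = c * -b := by ring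
  simp_rw [h, ← Finset.sum_smul, AddChar.sum_mulShift _ hψ, neg_eq_zero]
  rw [Finset.sum_eq_single 0 (fun b _ hb ↦ by simp [hb]) (by simp)]
  have h1 : (⟨0, 1⟩ : AffGroup F) = 1 := rfl
  simp [h1]

theorem exists_weightSpace_ne_bot [Nontrivial V] (hψ : ψ.IsPrimitive) :
    ∃ c, weightSpace ρ ψ c ≠ ⊥ := by
  by_contra! h
  obtain ⟨v, hv⟩ := exists_ne (0 : V)
  have h0 (c : F) : weightProj ρ ψ c v = 0 := by
    have := weightProj_mem (ρ := ρ) (ψ := ψ) c v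
    rwa [h c, Submodule.mem_bot] at this
  have := sum_weightProj_apply (ρ := ρ) hψ v
  simp only [h0, Finset.sum_const_zero] at this
  exact smul_ne_zero (Nat.cast_ne_zero.2 Fintype.card_ne_zero) hv this.symm

theorem linearIndependent_scaling (hψ : ψ.IsPrimitive) {c : F} (hc : c ≠ 0) {v : V}
    (hv : v ∈ weightSpace ρ ψ c) (hv0 : v ≠ 0) :
    LinearIndependent ℂ fun a : Fˣ ↦ ρ ⟨0, a⟩ v := by
  classical
  rw [Fintype.linearIndependent_iff]
  intro g hg a
  have h := congrArg (weightProj ρ ψ (c * (a⁻¹ : Fˣ))) hg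
  rw [map_sum, map_zero, Finset.sum_eq_single a] at h
  · rw [map_smul, weightProj_apply_of_mem hψ (scaling_mem_weightSpace hv a), if_pos rfl,
      smul_smul] at h
    have hne : ρ ⟨0, a⟩ v ≠ 0 := fun h0 ↦ hv0 <|
      (ρ.apply_bijective ⟨0, a⟩).injective (h0.trans (map_zero _).symm)
    simpa [hne] using h
  · intro a' _ ha
    rw [map_smul, weightProj_apply_of_mem hψ (scaling_mem_weightSpace hv a'), if_neg, smul_zero]
    intro h'
    exact ha (inv_injective (Units.ext (mul_left_cancel₀ hc h')))
  · simp

end AffGroup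

/-- For a finite field `F`, every irreducible finite-dimensional complex representation
of the affine group of `F` has dimension either `1` or `|F| − 1`. -/
theorem AffGroup.finrank_simple_fdRep (F : Type) [Field F] [Fintype F]
    (V : FDRep ℂ (AffGroup F)) (hV : CategoryTheory.Simple V) :
    Module.finrank ℂ V = 1 ∨ Module.finrank ℂ V = Fintype.card F - 1 := by
  classical
  have := FDRep.nontrivial_of_simple V
  have hψ := AddChar.FiniteField.primitiveChar_to_Complex_isPrimitive F
  set ψ := AddChar.FiniteField.primitiveChar_to_Complex F
  obtain ⟨c, hc⟩ := exists_weightSpace_ne_bot (ρ := V.ρ) hψ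
  rcases eq_or_ne c 0 with rfl | hc0
  · left
    have htop := V.toSubmodule_eq_top_of_simple (weightSpaceZero V.ρ ψ) hc
    obtain ⟨a, ha⟩ := IsCyclic.exists_generator (α := Fˣ)
    obtain ⟨μ, hμ⟩ := Module.End.exists_eigenvalue (V.ρ ⟨0, a⟩)
    obtain ⟨v, hv⟩ := hμ.exists_hasEigenvector
    have h := V.toSubmodule_eq_top_of_simple (spanEigenvector htop ha hv.apply_eq_smul)
      (by simpa [spanEigenvector] using hv.2)
    rw [← finrank_top ℂ V, ← h]
    exact finrank_span_singleton hv.2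
  · right
    obtain ⟨v, hv, hv0⟩ := Submodule.exists_mem_ne_zero_of_ne_bot hc
    have hli := linearIndependent_scaling hψ hc0 hv hv0
    have h := V.toSubmodule_eq_top_of_simple (spanScaling hv) fun h ↦
      hli.ne_zero 1 ((Submodule.eq_bot_iff _).1 h _ (Submodule.subset_span ⟨1, rfl⟩))
    rw [← finrank_top ℂ V, ← h, ← Fintype.card_units]
    exact finrank_span_eq_card hli
end

section
/- For every natural number k, the sign of the permutation X_k of Fin k × Fin k defined by X_k(i,j) = (j,i) is (−1)^{k(k−1)/2}; that is, sign(X_k) = +1 if k ≡ 0 or 1 (mod 4), and sign(X_k) = −1 if k ≡ 2 or 3 (mod 4). (Lemma 7.1 of the paper.) -/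
/-- The fixed points of the coordinate swap on `α × α` form the diagonal. -/
theorem card_fixedPoints_prodComm (α : Type*) [Fintype α] [DecidableEq α] :
    Fintype.card (Function.fixedPoints (Equiv.prodComm α α)) = Fintype.card α :=
  Fintype.card_congr
    { toFun := fun p => p.1.1
      invFun := fun a => ⟨(a, a), rfl⟩
      left_inv := by
        rintro ⟨⟨a, b⟩, h⟩
        obtain rfl : b = a := congrArg Prod.fst h
        rfl
      right_inv := fun _ => rfl }

/-- The sign of the coordinate swap on `α × α`. -/
theorem sign_prodComm (α : Type*) [Fintype α] [DecidableEq α] :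
    Equiv.Perm.sign (Equiv.prodComm α α) =
      (-1) ^ (Fintype.card α * (Fintype.card α - 1) / 2) := by
  have hsq : (Equiv.prodComm α α : Equiv.Perm (α × α)) ^ 2 = 1 := by
    ext ⟨a, b⟩ <;> rfl
  rw [Equiv.Perm.sign_of_pow_two_eq_one hsq, card_fixedPoints_prodComm, Fintype.card_prod,
    Nat.mul_sub_one]

/-- **Lemma 7.1.** The sign of the coordinate-swap permutation `X_k` of
`Fin k × Fin k` is `(−1) ^ (k(k−1)/2)`: it is `+1` if `k ≡ 0, 1 (mod 4)` and `−1`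
if `k ≡ 2, 3 (mod 4)`. -/
theorem sign_prodComm_fin (k : ℕ) :
    Equiv.Perm.sign (Equiv.prodComm (Fin k) (Fin k)) = (-1) ^ (k * (k - 1) / 2) ∧
    ((k % 4 = 0 ∨ k % 4 = 1) → Equiv.Perm.sign (Equiv.prodComm (Fin k) (Fin k)) = 1) ∧
    ((k % 4 = 2 ∨ k % 4 = 3) → Equiv.Perm.sign (Equiv.prodComm (Fin k) (Fin k)) = -1) := by
  have hsign := sign_prodComm (Fin k)
  rw [Fintype.card_fin] at hsign
  have hchoose : k * (k - 1) / 2 % 2 = k % 4 / 2 := by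
    obtain ⟨m, r, hr, rfl⟩ : ∃ m r, r < 4 ∧ k = 4 * m + r :=
      ⟨k / 4, k % 4, Nat.mod_lt _ (by norm_num), (Nat.div_add_mod k 4).symm⟩
    have hmul : (4 * m + r) * (4 * m + r - 1) = 4 * (m * (4 * m + 2 * r - 1)) + r * (r - 1) := by
      rcases Nat.eq_zero_or_pos m with rfl | hm
      · simp
      · zify [show 1 ≤ 4 * m + r by omega, show 1 ≤ 4 * m + 2 * r by omega]
        rcases Nat.eq_zero_or_pos r with rfl | hr'
        · push_cast; ring
        · push_cast [Nat.cast_sub hr']; ring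
    rw [hmul]
    interval_cases r <;> omega
  refine ⟨hsign, fun h => ?_, fun h => ?_⟩ <;> rw [hsign]
  · exact Even.neg_one_pow (Nat.even_iff.mpr (by omega))
  · exact Odd.neg_one_pow (Nat.odd_iff.mpr (by omega))
end

section
/- Let R be a commutative ring, let k be a natural number, let A, B, Λ be k × k matrices over R, and let u be a unit of R. If A·B = u·Λ·Λ and Aᵀ·B·Λ = u·I (where Aᵀ is the transpose of A and I is the k × k identity matrix), then (det Λ)³ = 1. (This is the determinant argument proving Proposition 7.4 of the paper, that L = det λ satisfies L³ = 1.) -/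
open Matrix

/-- The determinant argument of Proposition 7.4: if `A·B = u·(Λ·Λ)` and
`Aᵀ·B·Λ = u·I` for `k × k` matrices over a commutative ring, with `u` a unit,
then `(det Λ)³ = 1`. -/
theorem det_cubed_eq_one {R : Type*} [CommRing R] (k : ℕ)
    (A B Lam : Matrix (Fin k) (Fin k) R) (u : Rˣ)
    (h1 : A * B = (u : R) • (Lam * Lam))
    (h2 : Aᵀ * B * Lam = (u : R) • (1 : Matrix (Fin k) (Fin k) R)) :
    Lam.det ^ 3 = 1 := by
  have d1 := congrArg Matrix.det h1
  have d2 := congrArg Matrix.det h2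
  simp only [Matrix.det_mul, Matrix.det_smul, Matrix.det_transpose, Matrix.det_one,
    Fintype.card_fin] at d1 d2
  apply (u.isUnit.pow k).mul_left_cancel
  linear_combination d2 - Lam.det * d1
end
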